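/- arXiv:2008.05815 — 2 statements merged into one kernel-verified Lean document; each statement's English description precedes it below -/
import Mathlib

section
/- For every integer n ≥ 3 there is a constant C_n > 0 such that for all real t ≥ 1, the number of polynomials in R_n(t) satisfies t^n ≤ |R_n(t)| ≤ C_n · t^n. -/
open Polynomial

/-- The height of an integer polynomial: the maximum of the absolute values
of its coefficients. -/
def polyHeight (p : Polynomial ℤ) : ℕ :=
  p.support.sup fun i => (p.coeff i).natAbs

/-- `Rset n t` is the set of integer polynomials of degree exactly `n`,
height at most `t`, which are reducible over `ℚ`. -/
def Rset (n : ℕ) (t : ℝ) : Set (Polynomial ℤ) :=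
  {p | p.natDegree = n ∧ (polyHeight p : ℝ) ≤ t ∧
       ¬ Irreducible (p.map (Int.castRingHom ℚ))}

theorem polyHeight_le_iff {p : ℤ[X]} {h : ℕ} :
    polyHeight p ≤ h ↔ ∀ i, (p.coeff i).natAbs ≤ h := by
  simp only [polyHeight, Finset.sup_le_iff, mem_support_iff]
  refine forall_congr' fun i => ⟨fun hi => ?_, fun hi _ => hi⟩
  by_cases h0 : p.coeff i = 0
  · simp [h0]
  · exact hi h0

theorem natAbs_coeff_le_polyHeight (p : ℤ[X]) (i : ℕ) : (p.coeff i).natAbs ≤ polyHeight p :=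
  polyHeight_le_iff.1 le_rfl i

theorem polyHeight_pos {p : ℤ[X]} (hp : p ≠ 0) : 0 < polyHeight p :=
  (Int.natAbs_pos.2 (leadingCoeff_ne_zero.2 hp)).trans_le (natAbs_coeff_le_polyHeight p _)

theorem polyHeight_X_mul_le (p : ℤ[X]) : polyHeight (X * p) ≤ polyHeight p := by
  refine polyHeight_le_iff.2 fun i => ?_
  cases i with
  | zero => simp
  | succ i => simpa using natAbs_coeff_le_polyHeight p i

theorem polyHeight_eq_supNorm (p : ℤ[X]) :
    (polyHeight p : ℝ) = (p.map (Int.castRingHom ℂ)).supNorm := by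
  have norm_coeff (i : ℕ) :
      ‖(p.map (Int.castRingHom ℂ)).coeff i‖ = ((p.coeff i).natAbs : ℝ) := by
    simp [Nat.cast_natAbs]
  apply le_antisymm
  · rw [← Nat.le_floor_iff (supNorm_nonneg _), polyHeight_le_iff]
    intro i
    rw [Nat.le_floor_iff (supNorm_nonneg _), ← norm_coeff]
    exact le_supNorm _ _
  · obtain ⟨i, hi⟩ := (p.map (Int.castRingHom ℂ)).exists_eq_supNorm
    rw [hi, norm_coeff]
    exact_mod_cast natAbs_coeff_le_polyHeight p i

/-- Gelfond's inequality. -/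
theorem polyHeight_mul_polyHeight_le {q r : ℤ[X]} (hq : q ≠ 0) (hr : r ≠ 0) :
    polyHeight q * polyHeight r ≤
      2 ^ (q * r).natDegree * ((q * r).natDegree + 1) * polyHeight (q * r) := by
  have height_le (p : ℤ[X]) :
      (polyHeight p : ℝ) ≤ 2 ^ p.natDegree * (p.map (Int.castRingHom ℂ)).mahlerMeasure := by
    rw [polyHeight_eq_supNorm]
    refine (supNorm_le_choose_natDegree_div_two_mul_mahlerMeasure _).trans ?_
    rw [natDegree_map_eq_of_injective Int.cast_injective]
    exact mul_le_mul_of_nonneg_right (mod_cast Nat.choose_le_two_pow _ _) (mahlerMeasure_nonneg _)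
  have mahler_le (p : ℤ[X]) :
      (p.map (Int.castRingHom ℂ)).mahlerMeasure ≤ (p.natDegree + 1) * polyHeight p := by
    rw [polyHeight_eq_supNorm]
    refine (mahlerMeasure_le_sqrt_natDegree_add_one_mul_supNorm _).trans ?_
    rw [natDegree_map_eq_of_injective Int.cast_injective]
    refine mul_le_mul_of_nonneg_right (Real.sqrt_le_self_iff.2 (Or.inr ?_)) (supNorm_nonneg _)
    linarith [(Nat.cast_nonneg p.natDegree : (0 : ℝ) ≤ _)]
  rw [← Nat.cast_le (α := ℝ)]
  push_cast
  calc (polyHeight q : ℝ) * polyHeight r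
      ≤ (2 ^ q.natDegree * (q.map (Int.castRingHom ℂ)).mahlerMeasure) *
        (2 ^ r.natDegree * (r.map (Int.castRingHom ℂ)).mahlerMeasure) := by
        gcongr
        · exact mul_nonneg (by positivity) (mahlerMeasure_nonneg _)
        · exact height_le q
        · exact height_le r
    _ = 2 ^ (q * r).natDegree * ((q * r).map (Int.castRingHom ℂ)).mahlerMeasure := by
        rw [Polynomial.map_mul, mahlerMeasure_mul, natDegree_mul hq hr]
        ring
    _ ≤ 2 ^ (q * r).natDegree * (((q * r).natDegree + 1) * polyHeight (q * r)) := by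
        gcongr
        exact mahler_le _
    _ = _ := by ring

open Classical in
/-- The integer polynomials of degree less than `d` and height at most `h`. -/
noncomputable def heightBox (d h : ℕ) : Finset ℤ[X] :=
  (Fintype.piFinset fun _ : Fin d => Finset.Icc (-(h : ℤ)) h).image (ofFn d)

theorem card_heightBox (d h : ℕ) : (heightBox d h).card = (2 * h + 1) ^ d := by
  rw [heightBox, Finset.card_image_of_injective _ (injective_ofFn d)]
  simp only [Fintype.card_piFinset, Int.card_Icc, Finset.prod_const, Finset.card_univ,
    Fintype.card_fin]
  congr 1
  omega

theorem mem_heightBox {d h : ℕ} {p : ℤ[X]} :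
    p ∈ heightBox d h ↔ (∀ i, d ≤ i → p.coeff i = 0) ∧ polyHeight p ≤ h := by
  simp only [heightBox, Finset.mem_image, Fintype.mem_piFinset, Finset.mem_Icc]
  constructor
  · rintro ⟨v, hv, rfl⟩
    refine ⟨fun i hi => ofFn_coeff_eq_zero_of_ge v hi, polyHeight_le_iff.2 fun i => ?_⟩
    rcases lt_or_ge i d with hi | hi
    · rw [ofFn_coeff_eq_val_of_lt v hi]
      have := hv ⟨i, hi⟩
      omega
    · simp [ofFn_coeff_eq_zero_of_ge v hi]
  · rintro ⟨hd, hh⟩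
    refine ⟨fun i => p.coeff i, fun i => ?_, ?_⟩
    · have : (p.coeff i).natAbs ≤ h := polyHeight_le_iff.1 hh i
      dsimp only
      omega
    · ext i
      rcases lt_or_ge i d with hi | hi
      · rw [ofFn_coeff_eq_val_of_lt _ hi]
      · rw [ofFn_coeff_eq_zero_of_ge _ hi, hd i hi]

theorem heightBox_mono {d e h k : ℕ} (hde : d ≤ e) (hhk : h ≤ k) :
    heightBox d h ⊆ heightBox e k := fun _ hp =>
  mem_heightBox.2 ⟨fun i hi => (mem_heightBox.1 hp).1 i (hde.trans hi),
    (mem_heightBox.1 hp).2.trans hhk⟩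

theorem mem_heightBox_of_natDegree_le {d h : ℕ} {p : ℤ[X]} (hd : p.natDegree ≤ d)
    (hh : polyHeight p ≤ h) : p ∈ heightBox (d + 1) h :=
  mem_heightBox.2 ⟨fun _ hi => coeff_eq_zero_of_natDegree_lt (by omega), hh⟩

open Classical in
/-- The integer polynomials of degree less than `d` and height exactly `h`, for `h` positive. -/
noncomputable def heightSphere (d h : ℕ) : Finset ℤ[X] :=
  heightBox d h \ heightBox d (h - 1)

theorem mem_heightSphere_of_natDegree_le {d : ℕ} {p : ℤ[X]} (hp : p ≠ 0) (hd : p.natDegree ≤ d) :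
    p ∈ heightSphere (d + 1) (polyHeight p) := by
  refine Finset.mem_sdiff.2 ⟨mem_heightBox_of_natDegree_le hd le_rfl, fun h => ?_⟩
  have := (mem_heightBox.1 h).2
  have := polyHeight_pos hp
  omega

theorem add_pow_succ_le_pow_succ_add (x y m : ℕ) :
    (x + y) ^ (m + 1) ≤ x ^ (m + 1) + (m + 1) * y * (x + y) ^ m := by
  induction m with
  | zero => simp
  | succ m ih =>
    have hx : x ^ (m + 1) ≤ (x + y) ^ (m + 1) := Nat.pow_le_pow_left (by omega) _
    calc (x + y) ^ (m + 1 + 1) = (x + y) ^ (m + 1) * (x + y) := pow_succ _ _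
      _ ≤ (x ^ (m + 1) + (m + 1) * y * (x + y) ^ m) * (x + y) := by gcongr
      _ = x ^ (m + 1 + 1) + x ^ (m + 1) * y + (m + 1) * y * (x + y) ^ (m + 1) := by ring
      _ ≤ x ^ (m + 1 + 1) + (x + y) ^ (m + 1) * y + (m + 1) * y * (x + y) ^ (m + 1) := by gcongr
      _ = _ := by ring

theorem card_heightSphere_le (d : ℕ) {h : ℕ} (hh : 0 < h) :
    (heightSphere (d + 1) h).card ≤ 2 * (d + 1) * (3 * h) ^ d := by
  rw [heightSphere, Finset.card_sdiff_of_subset (heightBox_mono le_rfl (Nat.sub_le _ _)),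
    card_heightBox, card_heightBox, Nat.sub_le_iff_le_add']
  obtain ⟨m, rfl⟩ : ∃ m, h = m + 1 := ⟨h - 1, by omega⟩
  have key := add_pow_succ_le_pow_succ_add (2 * m + 1) 2 d
  have hpow : (2 * m + 1 + 2) ^ d ≤ (3 * (m + 1)) ^ d := Nat.pow_le_pow_left (by omega) _
  calc (2 * (m + 1) + 1) ^ (d + 1) = (2 * m + 1 + 2) ^ (d + 1) := by ring
    _ ≤ (2 * m + 1) ^ (d + 1) + (d + 1) * 2 * (2 * m + 1 + 2) ^ d := key
    _ ≤ (2 * m + 1) ^ (d + 1) + (d + 1) * 2 * (3 * (m + 1)) ^ d := by gcongr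
    _ = _ := by simp only [Nat.add_sub_cancel]; ring

theorem Polynomial.IsPrimitive.natDegree_pos_of_not_isUnit {p : ℤ[X]} (hp : p.IsPrimitive)
    (hu : ¬ IsUnit p) : 0 < p.natDegree := by
  rw [Nat.pos_iff_ne_zero]
  intro h0
  obtain ⟨a, rfl⟩ := natDegree_eq_zero.1 h0
  exact hu ((hp a dvd_rfl).map C)

theorem exists_mul_eq_of_not_irreducible_map {p : ℤ[X]} (hdeg : 0 < p.natDegree)
    (hp : ¬ Irreducible (p.map (Int.castRingHom ℚ))) :
    ∃ q r : ℤ[X], q * r = p ∧ 0 < q.natDegree ∧ 0 < r.natDegree := by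
  have hp0 : p ≠ 0 := ne_zero_of_natDegree_gt hdeg
  have hc : p.content ≠ 0 := content_eq_zero_iff.not.2 hp0
  have hprim := p.isPrimitive_primPart
  have hmap : p.map (Int.castRingHom ℚ) =
      C (p.content : ℚ) * p.primPart.map (Int.castRingHom ℚ) := by
    conv_lhs => rw [p.eq_C_content_mul_primPart]
    simp
  have hunit : IsUnit (C (p.content : ℚ)) := (IsUnit.mk0 _ (Int.cast_ne_zero.2 hc)).map C
  rw [hmap, irreducible_isUnit_mul hunit,
    ← IsPrimitive.Int.irreducible_iff_irreducible_map_cast hprim] at hp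
  have hnu : ¬ IsUnit p.primPart := fun hu => by
    have := natDegree_eq_zero_of_isUnit hu
    rw [natDegree_primPart] at this
    omega
  simp only [irreducible_iff, hnu, not_false_eq_true, true_and, not_forall, not_or] at hp
  obtain ⟨a, b, hab, ha, hb⟩ := hp
  have hap := isPrimitive_of_dvd hprim (Dvd.intro _ hab.symm)
  have hbp := isPrimitive_of_dvd hprim (Dvd.intro_left _ hab.symm)
  refine ⟨C p.content * a, b, ?_, ?_, hbp.natDegree_pos_of_not_isUnit hb⟩
  · rw [mul_assoc, ← hab, ← eq_C_content_mul_primPart]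
  · rw [natDegree_C_mul hc]
    exact hap.natDegree_pos_of_not_isUnit ha

theorem mem_Rset_iff {n : ℕ} {t : ℝ} (ht : 0 ≤ t) {p : ℤ[X]} :
    p ∈ Rset n t ↔ p.natDegree = n ∧ polyHeight p ≤ ⌊t⌋₊ ∧
      ¬ Irreducible (p.map (Int.castRingHom ℚ)) := by
  rw [Rset, Set.mem_ofPred_eq, Nat.le_floor_iff ht]

theorem Rset_finite (n : ℕ) {t : ℝ} (ht : 0 ≤ t) : (Rset n t).Finite :=
  (heightBox (n + 1) ⌊t⌋₊).finite_toSet.subset fun _ hp =>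
    mem_heightBox_of_natDegree_le ((mem_Rset_iff ht).1 hp).1.le ((mem_Rset_iff ht).1 hp).2.1

theorem pow_le_ncard_Rset (m : ℕ) {t : ℝ} (ht : 1 ≤ t) :
    t ^ (m + 2) ≤ (Rset (m + 2) t).ncard := by
  classical
  set N := ⌊t⌋₊
  let S : Finset ℤ[X] := heightBox (m + 2) N \ heightBox (m + 1) N
  have hS : S.card = 2 * N * (2 * N + 1) ^ (m + 1) := by
    rw [Finset.card_sdiff_of_subset (heightBox_mono (Nat.le_succ _) le_rfl), card_heightBox,
      card_heightBox, Nat.sub_eq_iff_eq_add (Nat.pow_le_pow_right (by omega) (by omega)),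
      pow_succ _ (m + 1)]
    ring
  have hsub : ((S.image (X * ·) : Finset ℤ[X]) : Set ℤ[X]) ⊆ Rset (m + 2) t := by
    intro p hp
    simp only [Finset.coe_image, Set.mem_image, Finset.mem_coe] at hp
    obtain ⟨r, hr, rfl⟩ := hp
    obtain ⟨hr1, hr2⟩ := Finset.mem_sdiff.1 hr
    have hlt : r.natDegree ≤ m + 1 :=
      natDegree_le_iff_coeff_eq_zero.2 fun i hi => (mem_heightBox.1 hr1).1 i hi
    have hge : m + 1 ≤ r.natDegree := by
      by_contra hlt
      exact hr2 (mem_heightBox_of_natDegree_le (by omega) (mem_heightBox.1 hr1).2)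
    have hr0 : r ≠ 0 := ne_zero_of_natDegree_gt (n := 0) (by omega)
    refine (mem_Rset_iff (by linarith)).2 ⟨?_, ?_, fun hirr => ?_⟩
    · rw [natDegree_X_mul hr0]
      omega
    · exact (polyHeight_X_mul_le r).trans (mem_heightBox.1 hr1).2
    · rw [Polynomial.map_mul, map_X] at hirr
      rcases hirr.isUnit_or_isUnit rfl with hu | hu
      · exact not_isUnit_X hu
      · have := natDegree_eq_zero_of_isUnit hu
        rw [natDegree_map_eq_of_injective Int.cast_injective] at this
        omega
  have hcard := Set.ncard_le_ncard hsub (Rset_finite _ (by linarith))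
  rw [Set.ncard_coe_finset, Finset.card_image_of_injective _ (mul_right_injective₀ X_ne_zero),
    hS] at hcard
  have hN1 : (1 : ℝ) ≤ N := mod_cast Nat.one_le_floor_iff t |>.2 ht
  have hN : t < N + 1 := Nat.lt_floor_add_one t
  calc t ^ (m + 2) = t * t ^ (m + 1) := by ring
    _ ≤ (2 * N) * (2 * N + 1) ^ (m + 1) := by gcongr <;> linarith
    _ ≤ _ := mod_cast hcard

open Classical in
/-- The products of a polynomial of degree at most `k` and one of degree at most `l`, with the
product of their heights at most `K`. -/
noncomputable def heightProducts (k l K : ℕ) : Finset ℤ[X] :=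
  (Finset.Icc 1 K).biUnion fun h =>
    Finset.image₂ (· * ·) (heightSphere (k + 1) h) (heightBox (l + 1) (K / h))

theorem mul_mem_heightProducts {k l K : ℕ} {q r : ℤ[X]} (hq0 : q ≠ 0) (hr0 : r ≠ 0)
    (hq : q.natDegree ≤ k) (hr : r.natDegree ≤ l) (hK : polyHeight q * polyHeight r ≤ K) :
    q * r ∈ heightProducts k l K := by
  have hqpos := polyHeight_pos hq0
  refine Finset.mem_biUnion.2 ⟨polyHeight q, Finset.mem_Icc.2 ⟨hqpos, ?_⟩,
    Finset.mem_image₂_of_mem (mem_heightSphere_of_natDegree_le hq0 hq)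
      (mem_heightBox_of_natDegree_le hr ?_)⟩
  · exact (Nat.le_mul_of_pos_right _ (polyHeight_pos hr0)).trans hK
  · rwa [Nat.le_div_iff_mul_le hqpos, mul_comm]

theorem card_heightProducts_le (k l K : ℕ) :
    ((heightProducts (k + 1) (l + 2) K).card : ℝ) ≤
      4 * (k + 2) * 3 ^ (k + l + 4) * (K : ℝ) ^ (k + l + 3) := by
  have term_le : ∀ h ∈ Finset.Icc 1 K,
      (((heightSphere (k + 2) h).card * (heightBox (l + 3) (K / h)).card : ℕ) : ℝ) ≤
        2 * (k + 2) * 3 ^ (k + l + 4) * (K : ℝ) ^ (k + l + 3) * ((h : ℝ) ^ 2)⁻¹ := by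
    intro h hh
    obtain ⟨h1, hK⟩ := Finset.mem_Icc.1 hh
    have hR : (1 : ℝ) ≤ h := mod_cast h1
    set x : ℝ := K / h
    have hx : (1 : ℝ) ≤ x := (one_le_div (by positivity)).2 (mod_cast hK)
    have hKx : (K : ℝ) = h * x := by
      simp only [x]
      field_simp
    have hmx : ((K / h : ℕ) : ℝ) ≤ x := Nat.cast_div_le
    have hsphere : ((heightSphere (k + 2) h).card : ℝ) ≤ 2 * (k + 2) * (3 * h) ^ (k + 1) := by
      have := card_heightSphere_le (k + 1) h1
      rw [← Nat.cast_le (α := ℝ)] at this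
      push_cast at this
      exact this.trans_eq (by ring)
    have hbox : ((heightBox (l + 3) (K / h)).card : ℝ) ≤ (3 * x) ^ (l + 3) := by
      rw [card_heightBox]
      push_cast
      gcongr
      linarith
    push_cast
    calc ((heightSphere (k + 2) h).card : ℝ) * (heightBox (l + 3) (K / h)).card
        ≤ (2 * (k + 2) * (3 * h) ^ (k + 1)) * (3 * x) ^ (l + 3) :=
          mul_le_mul hsphere hbox (Nat.cast_nonneg _) (by positivity)
      _ = 2 * (k + 2) * 3 ^ (k + l + 4) * ((h : ℝ) ^ (k + 1) * x ^ (l + 3)) := by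
          rw [mul_pow, mul_pow, show k + l + 4 = (k + 1) + (l + 3) by omega, pow_add]
          ring
      _ ≤ 2 * (k + 2) * 3 ^ (k + l + 4) * ((h : ℝ) ^ (k + l + 1) * x ^ (k + l + 3)) := by
          gcongr _ * (?_ * ?_)
          · exact pow_le_pow_right₀ hR (by omega)
          · exact pow_le_pow_right₀ hx (by omega)
      _ = _ := by
          rw [hKx]
          field_simp
          ring
  have hsum : ∑ h ∈ Finset.Icc 1 K, ((h : ℝ) ^ 2)⁻¹ ≤ 2 := by
    have := sum_Ioo_inv_sq_le (α := ℝ) 0 (K + 1)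
    have hI : Finset.Ioo 0 (K + 1) = Finset.Icc 1 K := by ext; simp; omega
    simpa [hI] using this
  have hcard : (heightProducts (k + 1) (l + 2) K).card ≤ ∑ h ∈ Finset.Icc 1 K,
      (heightSphere (k + 2) h).card * (heightBox (l + 3) (K / h)).card :=
    Finset.card_biUnion_le.trans (Finset.sum_le_sum fun h _ => Finset.card_image₂_le _ _ _)
  calc ((heightProducts (k + 1) (l + 2) K).card : ℝ)
      ≤ ∑ h ∈ Finset.Icc 1 K,
        (((heightSphere (k + 2) h).card * (heightBox (l + 3) (K / h)).card : ℕ) : ℝ) :=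
        mod_cast hcard
    _ ≤ _ := Finset.sum_le_sum term_le
    _ = 2 * (k + 2) * 3 ^ (k + l + 4) * (K : ℝ) ^ (k + l + 3) *
        ∑ h ∈ Finset.Icc 1 K, ((h : ℝ) ^ 2)⁻¹ := by rw [Finset.mul_sum]
    _ ≤ 2 * (k + 2) * 3 ^ (k + l + 4) * (K : ℝ) ^ (k + l + 3) * 2 := by gcongr
    _ = _ := by ring

theorem ncard_Rset_le (m : ℕ) {t : ℝ} (ht : 0 ≤ t) :
    ((Rset (m + 3) t).ncard : ℝ) ≤ (m + 1) * (4 * (m + 2) * 3 ^ (m + 4)) *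
      (2 ^ (m + 3) * (m + 4)) ^ (m + 3) * t ^ (m + 3) := by
  classical
  set K : ℕ := 2 ^ (m + 3) * (m + 4) * ⌊t⌋₊ with hK
  have hsub : Rset (m + 3) t ⊆ ((Finset.range (m + 1)).biUnion fun k =>
      heightProducts (k + 1) (m - k + 2) K : Finset ℤ[X]) := by
    intro p hp
    obtain ⟨hdeg, hheight, hred⟩ := (mem_Rset_iff ht).1 hp
    obtain ⟨q, r, rfl, hq, hr⟩ := exists_mul_eq_of_not_irreducible_map (by omega) hred
    have hq0 : q ≠ 0 := ne_zero_of_natDegree_gt hq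
    have hr0 : r ≠ 0 := ne_zero_of_natDegree_gt hr
    have hle : polyHeight q * polyHeight r ≤ K := by
      refine (polyHeight_mul_polyHeight_le hq0 hr0).trans ?_
      rw [hdeg, hK]
      gcongr
    rw [natDegree_mul hq0 hr0] at hdeg
    simp only [Finset.coe_biUnion, Set.mem_iUnion, Finset.mem_coe, Finset.mem_range]
    rcases le_or_gt 2 r.natDegree with h2 | h2
    · exact ⟨q.natDegree - 1, by omega,
        mul_mem_heightProducts hq0 hr0 (by omega) (by omega) hle⟩
    · rw [mul_comm q r]
      exact ⟨r.natDegree - 1, by omega,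
        mul_mem_heightProducts hr0 hq0 (by omega) (by omega) (by rwa [mul_comm])⟩
  have hcard := (Set.ncard_le_ncard hsub (Finset.finite_toSet _)).trans_eq
    (Set.ncard_coe_finset _)
  have hKt : (K : ℝ) ≤ 2 ^ (m + 3) * (m + 4) * t := by
    rw [hK]
    push_cast
    gcongr
    exact Nat.floor_le ht
  calc ((Rset (m + 3) t).ncard : ℝ)
      ≤ ∑ k ∈ Finset.range (m + 1), ((heightProducts (k + 1) (m - k + 2) K).card : ℝ) :=
        mod_cast hcard.trans Finset.card_biUnion_le
    _ ≤ ∑ k ∈ Finset.range (m + 1), 4 * (m + 2) * 3 ^ (m + 4) * (K : ℝ) ^ (m + 3) := by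
        refine Finset.sum_le_sum fun k hk => (card_heightProducts_le k (m - k) K).trans ?_
        have hkm : k ≤ m := Nat.lt_succ_iff.1 (Finset.mem_range.1 hk)
        rw [Nat.add_sub_cancel' hkm]
        gcongr
    _ = (m + 1) * (4 * (m + 2) * 3 ^ (m + 4)) * (K : ℝ) ^ (m + 3) := by
        simp
        ring
    _ ≤ (m + 1) * (4 * (m + 2) * 3 ^ (m + 4)) * (2 ^ (m + 3) * (m + 4) * t) ^ (m + 3) := by
        gcongr
    _ = _ := by
        rw [mul_pow _ t]
        ring

/-- For every integer `n ≥ 3` there is a constant `C_n > 0` such that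
`t^n ≤ |R_n(t)| ≤ C_n · t^n` for all `t ≥ 1`. -/
theorem stmt0 :
    ∀ n : ℕ, 3 ≤ n → ∃ C : ℝ, 0 < C ∧ ∀ t : ℝ, 1 ≤ t →
      t ^ n ≤ ((Rset n t).ncard : ℝ) ∧ ((Rset n t).ncard : ℝ) ≤ C * t ^ n := by
  intro n hn
  obtain ⟨m, rfl⟩ : ∃ m, n = m + 3 := ⟨n - 3, by omega⟩
  exact ⟨(m + 1) * (4 * (m + 2) * 3 ^ (m + 4)) * (2 ^ (m + 3) * (m + 4)) ^ (m + 3),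
    by positivity, fun t ht =>
      ⟨pow_le_ncard_Rset (m + 1) ht, ncard_Rset_le m (zero_le_one.trans ht)⟩⟩
end

section
/- As T → ∞, one has T² log T ≪ ∑_{(x,y) ∈ G(T)} φ(x)·φ(y), where the sum is over the lattice points G(T) = {(x,y) ∈ ℤ² : x ≥ 1, y ≥ 1, xy ≤ T}; that is, there is a positive constant c such that the sum is at least c · T² log T for all sufficiently large T. -/
/-- The lattice points `G(T) = {(x,y) ∈ ℤ² : x ≥ 1, y ≥ 1, xy ≤ T}`
(encoded via positive natural numbers). -/
noncomputable def latticeG (T : ℝ) : Finset (ℕ × ℕ) :=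
  (Finset.Icc 1 ⌊T⌋₊ ×ˢ Finset.Icc 1 ⌊T⌋₊).filter fun p => ((p.1 * p.2 : ℕ) : ℝ) ≤ T

/-- The Euler totient function as a real-valued arithmetic function. -/
def realTotient : ArithmeticFunction ℝ :=
  ⟨fun n => (Nat.totient n : ℝ), by simp⟩

theorem realTotient_apply (n : ℕ) : realTotient n = (Nat.totient n : ℝ) := rfl

theorem zeta_mul_realTotient (n : ℕ) :
    (((ArithmeticFunction.zeta : ArithmeticFunction ℕ) : ArithmeticFunction ℝ) * realTotient) n
      = (n : ℝ) := by
  rw [ArithmeticFunction.coe_zeta_mul_apply]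
  simp only [realTotient_apply]
  exact_mod_cast Nat.sum_totient n

theorem sum_Ioc_id_cast (N : ℕ) :
    ∑ n ∈ Finset.Ioc 0 N, (n : ℝ) = (N : ℝ) * (N + 1) / 2 := by
  induction N with
  | zero => simp
  | succ k ih =>
    rw [Finset.sum_Ioc_succ_top (Nat.zero_le k), ih]
    push_cast
    ring

theorem sum_Ioc_one_inv_sq_le (N : ℕ) (hN : 1 ≤ N) :
    ∑ d ∈ Finset.Ioc 1 N, 1 / (d : ℝ) ^ 2 ≤ 2 / 3 - 2 / (2 * (N : ℝ) + 1) := by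
  induction N, hN using Nat.le_induction with
  | base => norm_num
  | succ k hk ih =>
    rw [Finset.sum_Ioc_succ_top hk]
    have hk0 : (0 : ℝ) ≤ k := by positivity
    have step : 1 / ((k + 1 : ℕ) : ℝ) ^ 2
        ≤ 2 / (2 * (k : ℝ) + 1) - 2 / (2 * ((k + 1 : ℕ) : ℝ) + 1) := by
      push_cast
      rw [div_sub_div _ _ (by positivity) (by positivity),
        div_le_div_iff₀ (by positivity) (by positivity)]
      nlinarith
    linarith

theorem sum_realTotient_le (N : ℕ) :
    ∑ n ∈ Finset.Ioc 0 N, realTotient n ≤ ((N : ℝ) ^ 2 + 1) / 2 := by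
  induction N with
  | zero => norm_num
  | succ k ih =>
    rw [Finset.sum_Ioc_succ_top (Nat.zero_le k), realTotient_apply]
    rcases Nat.eq_zero_or_pos k with rfl | hk
    · norm_num
    · have h : Nat.totient (k + 1) ≤ k :=
        Nat.lt_succ_iff.mp (Nat.totient_lt (k + 1) (by omega))
      have h' : (Nat.totient (k + 1) : ℝ) ≤ k := by exact_mod_cast h
      push_cast
      nlinarith

theorem le_sum_realTotient (N : ℕ) :
    (N : ℝ) ^ 2 / 6 ≤ ∑ n ∈ Finset.Ioc 0 N, realTotient n := by
  rcases Nat.eq_zero_or_pos N with rfl | hN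
  · simp
  have key := ArithmeticFunction.sum_Ioc_mul_eq_sum_sum
    ((ArithmeticFunction.zeta : ArithmeticFunction ℕ) : ArithmeticFunction ℝ) realTotient N
  simp only [zeta_mul_realTotient] at key
  rw [sum_Ioc_id_cast, ← Finset.sum_Ioc_consecutive _ (Nat.zero_le 1) hN] at key
  have tail : ∑ d ∈ Finset.Ioc 1 N,
      ((ArithmeticFunction.zeta : ArithmeticFunction ℕ) : ArithmeticFunction ℝ) d
        * ∑ m ∈ Finset.Ioc 0 (N / d), realTotient m
      ≤ ∑ d ∈ Finset.Ioc 1 N, ((N : ℝ) ^ 2 / 2 * (1 / (d : ℝ) ^ 2) + 1 / 2) := by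
    refine Finset.sum_le_sum fun d hd => ?_
    have hd1 : 1 < d := (Finset.mem_Ioc.mp hd).1
    have hd0 : d ≠ 0 := by omega
    have hζ : ((ArithmeticFunction.zeta : ArithmeticFunction ℕ) : ArithmeticFunction ℝ) d = 1 := by
      simp [ArithmeticFunction.natCoe_apply, ArithmeticFunction.zeta_apply, hd0]
    rw [hζ, one_mul]
    have hle : ((N / d : ℕ) : ℝ) ≤ (N : ℝ) / d := Nat.cast_div_le
    have hsq : ((N / d : ℕ) : ℝ) ^ 2 ≤ ((N : ℝ) / d) ^ 2 := by gcongr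
    rw [div_pow] at hsq
    have heq : (N : ℝ) ^ 2 / 2 * (1 / (d : ℝ) ^ 2) = (N : ℝ) ^ 2 / (d : ℝ) ^ 2 / 2 := by ring
    linarith [sum_realTotient_le (N / d)]
  rw [Finset.sum_add_distrib, ← Finset.mul_sum] at tail
  simp only [Finset.sum_const, Nat.card_Ioc, nsmul_eq_mul] at tail
  rw [Nat.cast_sub hN] at tail
  have hsum : ∑ d ∈ Finset.Ioc 1 N, 1 / (d : ℝ) ^ 2 ≤ 2 / 3 :=
    (sum_Ioc_one_inv_sq_le N hN).trans (sub_le_self _ (by positivity))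
  have hmul := mul_le_mul_of_nonneg_left hsum (by positivity : (0 : ℝ) ≤ (N : ℝ) ^ 2 / 2)
  have head : ∑ d ∈ Finset.Ioc 0 1,
      ((ArithmeticFunction.zeta : ArithmeticFunction ℕ) : ArithmeticFunction ℝ) d
        * ∑ m ∈ Finset.Ioc 0 (N / d), realTotient m = ∑ m ∈ Finset.Ioc 0 N, realTotient m := by
    simp [ArithmeticFunction.natCoe_apply, ArithmeticFunction.zeta_apply]
  rw [head] at key
  push_cast at tail
  nlinarith

theorem harmonic_add_le_sum_realTotient_div_sq (N : ℕ) (hN : 1 ≤ N) :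
    (harmonic N : ℝ) / 6 + (∑ n ∈ Finset.Ioc 0 N, realTotient n) / (N : ℝ) ^ 2 - 1 / 6
      ≤ ∑ n ∈ Finset.Ioc 0 N, realTotient n / (n : ℝ) ^ 2 := by
  induction N, hN using Nat.le_induction with
  | base => norm_num [harmonic]
  | succ k hk ih =>
    rw [Finset.sum_Ioc_succ_top (Nat.zero_le k), Finset.sum_Ioc_succ_top (Nat.zero_le k),
      harmonic_succ]
    have hk0 : (0 : ℝ) < k := by exact_mod_cast hk
    have hdiff : 0 ≤ 1 / (k : ℝ) ^ 2 - 1 / ((k : ℝ) + 1) ^ 2 := by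
      rw [sub_nonneg]
      gcongr
      linarith
    have hmul := mul_le_mul_of_nonneg_right (le_sum_realTotient k) hdiff
    have hstep : ((k : ℝ) + 1)⁻¹ / 6
        ≤ (k : ℝ) ^ 2 / 6 * (1 / (k : ℝ) ^ 2 - 1 / ((k : ℝ) + 1) ^ 2) := by
      have : (k : ℝ) ^ 2 / 6 * (1 / (k : ℝ) ^ 2 - 1 / ((k : ℝ) + 1) ^ 2) - ((k : ℝ) + 1)⁻¹ / 6
          = k / (6 * ((k : ℝ) + 1) ^ 2) := by
        field_simp
        ring
      have h0 : 0 ≤ k / (6 * ((k : ℝ) + 1) ^ 2) := by positivity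
      linarith
    push_cast
    set S := ∑ n ∈ Finset.Ioc 0 k, realTotient n
    have hS : S * (1 / (k : ℝ) ^ 2 - 1 / ((k : ℝ) + 1) ^ 2)
        = S / (k : ℝ) ^ 2 - S / ((k : ℝ) + 1) ^ 2 := by ring
    rw [add_div, add_div]
    linarith

theorem log_le_sum_realTotient_div_sq (N : ℕ) (hN : 1 ≤ N) :
    Real.log (N + 1) / 6 ≤ ∑ n ∈ Finset.Ioc 0 N, realTotient n / (n : ℝ) ^ 2 := by
  have hlog := log_add_one_le_harmonic N
  push_cast at hlog
  have hN0 : (0 : ℝ) < (N : ℝ) ^ 2 := by positivity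
  have hlow : (1 : ℝ) / 6 ≤ (∑ n ∈ Finset.Ioc 0 N, realTotient n) / (N : ℝ) ^ 2 := by
    rw [le_div_iff₀ hN0]
    linarith [le_sum_realTotient N]
  linarith [harmonic_add_le_sum_realTotient_div_sq N hN]

theorem sum_latticeG_eq (T : ℝ) (hT : 0 ≤ T) :
    ∑ p ∈ latticeG T, (Nat.totient p.1 : ℝ) * (Nat.totient p.2 : ℝ)
      = ∑ n ∈ Finset.Ioc 0 ⌊T⌋₊, realTotient n * ∑ m ∈ Finset.Ioc 0 (⌊T⌋₊ / n), realTotient m := by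
  rw [← ArithmeticFunction.sum_Ioc_mul_eq_sum_sum,
    ArithmeticFunction.sum_Ioc_mul_eq_sum_prod_filter]
  refine Finset.sum_congr ?_ fun _ _ => rfl
  ext p
  simp only [latticeG, Finset.mem_filter, Finset.mem_product, Finset.mem_Icc, Finset.mem_Ioc,
    Nat.le_floor_iff hT, Nat.succ_le_iff]

/-- As `T → ∞`, `T² log T ≪ ∑_{(x,y) ∈ G(T)} φ(x) φ(y)`. -/
theorem stmt14 :
    ∃ c : ℝ, 0 < c ∧ ∃ T₀ : ℝ, ∀ T : ℝ, T₀ ≤ T →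
      c * T ^ 2 * Real.log T
        ≤ ∑ p ∈ latticeG T, (Nat.totient p.1 : ℝ) * (Nat.totient p.2 : ℝ) := by
  refine ⟨1 / 144, by norm_num, 1, fun T hT => ?_⟩
  have hT0 : 0 ≤ T := by linarith
  have hN : 1 ≤ ⌊T⌋₊ := Nat.one_le_floor_iff T |>.mpr hT
  have hlogT : Real.log T ≤ Real.log (⌊T⌋₊ + 1) :=
    Real.log_le_log (by linarith) (Nat.lt_floor_add_one T).le
  have hlog := log_le_sum_realTotient_div_sq ⌊T⌋₊ hN
  rw [sum_latticeG_eq T hT0]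
  calc 1 / 144 * T ^ 2 * Real.log T
      ≤ T ^ 2 / 24 * (Real.log (⌊T⌋₊ + 1) / 6) := by nlinarith [sq_nonneg T]
    _ ≤ T ^ 2 / 24 * ∑ n ∈ Finset.Ioc 0 ⌊T⌋₊, realTotient n / (n : ℝ) ^ 2 := by gcongr
    _ = ∑ n ∈ Finset.Ioc 0 ⌊T⌋₊, realTotient n * ((T / n / 2) ^ 2 / 6) := by
      rw [Finset.mul_sum]
      exact Finset.sum_congr rfl fun n _ => by ring
    _ ≤ _ := by
      refine Finset.sum_le_sum fun n hn => ?_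
      obtain ⟨hn0, hnT⟩ := Finset.mem_Ioc.mp hn
      have hn0' : (0 : ℝ) < n := by exact_mod_cast hn0
      have hquot : 1 ≤ T / n := by
        rw [le_div_iff₀ hn0', one_mul]
        exact (Nat.le_floor_iff hT0).mp hnT
      have hfloor : (1 : ℝ) ≤ ⌊T / n⌋₊ := by
        exact_mod_cast (Nat.one_le_floor_iff (T / n)).mpr hquot
      have hhalf : T / n / 2 ≤ ((⌊T⌋₊ / n : ℕ) : ℝ) := by
        rw [← Nat.floor_div_natCast]
        linarith [Nat.lt_floor_add_one (T / n)]
      refine mul_le_mul_of_nonneg_left ?_ (Nat.cast_nonneg _)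
      refine le_trans ?_ (le_sum_realTotient (⌊T⌋₊ / n))
      gcongr
end
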